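/- Let T be a triangulated category and P a presilting subcategory closed under direct summands, with S = thick(P). Assume P is covariantly finite in ^⊥(P[>0]) and contravariantly finite in (P[<0])^⊥, and for every X ∈ T one has Hom(X, P[ℓ]) = 0 = Hom(P, X[ℓ]) for ℓ ≫ 0. Set X := ∪_{i>0} P[-i]*⋯*P[-1], Y := ∪_{i>0} P*P[1]*⋯*P[i], and Z := (P[<0])^⊥ ∩ ^⊥(P[>0]). Then the composition Z ⊂ T → T/S induces a triangle equivalence Z/[P] ≃ T/S, and T = X ⊥ Z ⊥ Y[1]. -/

import Mathlib

open CategoryTheory Limits Pretriangulated ZeroObject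

namespace IY

variable {T : Type*} [Category T] [Preadditive T] [HasZeroObject T] [HasShift T ℤ]
  [∀ n : ℤ, (shiftFunctor T n).Additive] [Pretriangulated T]

/-- Right Hom-orthogonal: `A^⊥`. -/
def rightPerp (A : Set T) : Set T := {Y | ∀ X ∈ A, ∀ f : X ⟶ Y, f = 0}

/-- Left Hom-orthogonal: `^⊥B`. -/
def leftPerp (B : Set T) : Set T := {X | ∀ Y ∈ B, ∀ f : X ⟶ Y, f = 0}

/-- The shift `A[n]` of a class of objects. -/
def shiftSet (A : Set T) (n : ℤ) : Set T := (fun X => (X⟦n⟧ : T)) '' A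

/-- `Hom(A, B) = 0`. -/
def homOrth (A B : Set T) : Prop := ∀ X ∈ A, ∀ Y ∈ B, ∀ f : X ⟶ Y, f = 0

/-- `A * B`: objects `E` admitting a distinguished triangle `A → E → B → A[1]`
with `A ∈ A`, `B ∈ B`. -/
def starSet (A B : Set T) : Set T :=
  {E | ∃ (a b : T) (_ : a ∈ A) (_ : b ∈ B) (f : a ⟶ E) (g : E ⟶ b)
    (h : b ⟶ a⟦(1 : ℤ)⟧), Triangle.mk f g h ∈ distTriang T}

/-- A torsion pair `S = A ⊥ B` on the class of objects `S`:
`S = A * B`, `Hom(A,B) = 0`, `A = ^⊥B ∩ S` and `B = A^⊥ ∩ S`. -/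
structure IsTorsionPair (S A B : Set T) : Prop where
  subA : A ⊆ S
  subB : B ⊆ S
  orth : homOrth A B
  ext : S ⊆ starSet A B
  eqA : A = leftPerp B ∩ S
  eqB : B = rightPerp A ∩ S

/-- A thick subcategory: closed under isomorphisms, shifts, extensions (cones) and
direct summands (retracts), and contains the zero object. -/
structure IsThick (S : Set T) : Prop where
  zero : (0 : T) ∈ S
  iso : ∀ ⦃X Y : T⦄, (X ≅ Y) → X ∈ S → Y ∈ S
  shift : ∀ X ∈ S, ∀ n : ℤ, (X⟦n⟧ : T) ∈ S
  ext₂ : ∀ Tr : Triangle T, Tr ∈ (distTriang T) → Tr.obj₁ ∈ S → Tr.obj₃ ∈ S → Tr.obj₂ ∈ S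
  retract : ∀ ⦃X Y : T⦄ (i : X ⟶ Y) (r : Y ⟶ X), i ≫ r = 𝟙 X → Y ∈ S → X ∈ S

/-- The class of morphisms whose cone lies in `S`; the Verdier quotient `T/S` is the
localization of `T` at this class. -/
def qis (S : Set T) : MorphismProperty T := fun X Y f =>
  ∃ (Z : T) (g : Y ⟶ Z) (h : Z ⟶ X⟦(1 : ℤ)⟧),
    Triangle.mk f g h ∈ (distTriang T) ∧ Z ∈ S

/-- A morphism factors through an object of `P`. -/
def factorsThrough (P : Set T) {M N : T} (f : M ⟶ N) : Prop :=
  ∃ (P₀ : T) (_ : P₀ ∈ P) (g : M ⟶ P₀) (h : P₀ ⟶ N), g ≫ h = f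


/-- The thick closure of a class of objects. -/
def thickClosure (P : Set T) : Set T := ⋂₀ {S | IsThick S ∧ P ⊆ S}

/-- `P` is presilting: `Hom(P, P[i]) = 0` for all `i > 0`. -/
def presilting (P : Set T) : Prop :=
  ∀ X ∈ P, ∀ Y ∈ P, ∀ i : ℤ, 0 < i → ∀ f : X ⟶ (Y⟦i⟧ : T), f = 0

/-- `P[>0] = ⋃_{i>0} P[i]`. -/
def posPart (P : Set T) : Set T := {Z | ∃ X ∈ P, ∃ i : ℤ, 0 < i ∧ Z = (X⟦i⟧ : T)}

/-- `P[<0] = ⋃_{i<0} P[i]`. -/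
def negPart (P : Set T) : Set T := {Z | ∃ X ∈ P, ∃ i : ℤ, i < 0 ∧ Z = (X⟦i⟧ : T)}

/-- `P[-(n+1)] * ⋯ * P[-2] * P[-1]`. -/
def negChain (P : Set T) : ℕ → Set T
  | 0 => shiftSet P (-1)
  | n + 1 => starSet (shiftSet P (-((n : ℤ) + 2))) (negChain P n)

/-- `P * P[1] * ⋯ * P[n]`. -/
def posChain (P : Set T) : ℕ → Set T
  | 0 => P
  | n + 1 => starSet (posChain P n) (shiftSet P ((n : ℤ) + 1))

/-- `X := ⋃_{i>0} P[-i] * ⋯ * P[-1]`. -/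
def siltX (P : Set T) : Set T := ⋃ n : ℕ, negChain P n

/-- `Y := ⋃_{i>0} P * P[1] * ⋯ * P[i]`. -/
def siltY (P : Set T) : Set T := ⋃ n : ℕ, posChain P n

/-- `a : A ⟶ B` is a left `P`-approximation. -/
def isLeftApprox (P : Set T) {A B : T} (a : A ⟶ B) : Prop :=
  B ∈ P ∧ ∀ P' ∈ P, ∀ f : A ⟶ P', ∃ g : B ⟶ P', a ≫ g = f

/-- `b : A ⟶ B` is a right `P`-approximation. -/
def isRightApprox (P : Set T) {A B : T} (b : A ⟶ B) : Prop :=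
  A ∈ P ∧ ∀ P' ∈ P, ∀ f : P' ⟶ B, ∃ g : P' ⟶ A, g ≫ b = f

/-- `P` is covariantly finite in `A`. -/
def covFinite (P A : Set T) : Prop := ∀ X ∈ A, ∃ (B : T) (a : X ⟶ B), isLeftApprox P a

/-- `P` is contravariantly finite in `A`. -/
def contraFinite (P A : Set T) : Prop := ∀ X ∈ A, ∃ (B : T) (b : B ⟶ X), isRightApprox P b


set_option linter.unusedSectionVars false

/-- Objects isomorphic to some `B⟦n⟧` with `B ∈ P`. -/
def Pn (P : Set T) (n : ℤ) : Set T := {E | ∃ B ∈ P, Nonempty (E ≅ (B⟦n⟧ : T))}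

lemma Pn_mk {P : Set T} {B : T} (hB : B ∈ P) (n : ℤ) : (B⟦n⟧ : T) ∈ Pn P n :=
  ⟨B, hB, ⟨Iso.refl _⟩⟩

lemma Pn_iso {P : Set T} {n : ℤ} {D E : T} (e : D ≅ E) (h : E ∈ Pn P n) : D ∈ Pn P n := by
  obtain ⟨B, hB, ⟨i⟩⟩ := h
  exact ⟨B, hB, ⟨e ≪≫ i⟩⟩

lemma Pn_shift {P : Set T} {n : ℤ} {E : T} (h : E ∈ Pn P n) (k m : ℤ) (hm : n + k = m) :
    (E⟦k⟧ : T) ∈ Pn P m := by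
  obtain ⟨B, hB, ⟨i⟩⟩ := h
  exact ⟨B, hB, ⟨(shiftFunctor T k).mapIso i ≪≫ ((shiftFunctorAdd' T n k m hm).app B).symm⟩⟩

lemma tr1 {X Y : T} (k m : ℤ) (hk : m + k = 0) (h : ∀ g : (X⟦k⟧ : T) ⟶ Y, g = 0)
    (f : X ⟶ (Y⟦m⟧ : T)) : f = 0 := by
  have h1 := h (f⟦k⟧' ≫ (shiftFunctorCompIsoId T m k hk).hom.app Y)
  have h2 : f⟦k⟧' = 0 := by
    rw [← cancel_mono ((shiftFunctorCompIsoId T m k hk).hom.app Y), h1, zero_comp]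
  exact (Functor.map_eq_zero_iff (shiftFunctor T k)).1 h2

lemma tr2 {X Y : T} (k m : ℤ) (hk : k + m = 0) (h : ∀ g : X ⟶ (Y⟦m⟧ : T), g = 0)
    (f : (X⟦k⟧ : T) ⟶ Y) : f = 0 := by
  have h1 := h ((shiftFunctorCompIsoId T k m hk).inv.app X ≫ f⟦m⟧')
  have h2 : f⟦m⟧' = 0 := by
    rw [← cancel_epi ((shiftFunctorCompIsoId T k m hk).inv.app X), h1, comp_zero]
  exact (Functor.map_eq_zero_iff (shiftFunctor T m)).1 h2

lemma tr_iso_left {X X' Y : T} (e : X ≅ X') (h : ∀ g : X' ⟶ Y, g = 0) (f : X ⟶ Y) : f = 0 := by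
  rw [← cancel_epi e.inv, h (e.inv ≫ f), comp_zero]

lemma tr_iso_right {X Y Y' : T} (e : Y ≅ Y') (h : ∀ g : X ⟶ Y', g = 0) (f : X ⟶ Y) : f = 0 := by
  rw [← cancel_mono e.hom, h (f ≫ e.hom), zero_comp]

lemma Pn_hom {P : Set T} (hpre : presilting P) {a b : ℤ} (hab : a < b) {D E : T}
    (hD : D ∈ Pn P a) (hE : E ∈ Pn P b) (f : D ⟶ E) : f = 0 := by
  obtain ⟨B, hB, ⟨i⟩⟩ := hD
  obtain ⟨C, hC, ⟨j⟩⟩ := hE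
  refine tr_iso_left i (tr_iso_right j (tr2 a (-a) (by lia) ?_)) f
  exact tr_iso_right ((shiftFunctorAdd' T b (-a) (b - a) (by lia)).app C).symm
    (hpre B hB C hC (b - a) (by lia))

/-- a left-perp object has no maps to `Pn i` for `i>0` -/
lemma leftPerp_iff {P : Set T} {X : T} : X ∈ leftPerp (posPart P) ↔
    ∀ i : ℤ, 0 < i → ∀ E ∈ Pn P i, ∀ f : X ⟶ E, f = 0 := by
  constructor
  · rintro h i hi E ⟨B, hB, ⟨e⟩⟩
    exact tr_iso_right e (h _ ⟨B, hB, i, hi, rfl⟩)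
  · rintro h Y ⟨B, hB, i, hi, rfl⟩ f
    exact h i hi _ (Pn_mk hB i) f

lemma rightPerp_iff {P : Set T} {X : T} : X ∈ rightPerp (negPart P) ↔
    ∀ i : ℤ, i < 0 → ∀ E ∈ Pn P i, ∀ f : E ⟶ X, f = 0 := by
  constructor
  · rintro h i hi E ⟨B, hB, ⟨e⟩⟩
    exact tr_iso_left e (h _ ⟨B, hB, i, hi, rfl⟩)
  · rintro h Y ⟨B, hB, i, hi, rfl⟩ f
    exact h i hi _ (Pn_mk hB i) f

lemma starSet_of_iso {A B : Set T} (Tr : Triangle T) (hTr : Tr ∈ distTriang T) {a b : T}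
    (ha : a ∈ A) (hb : b ∈ B) (e : Tr.obj₁ ≅ a) (e' : Tr.obj₃ ≅ b) : Tr.obj₂ ∈ starSet A B := by
  refine ⟨a, b, ha, hb, e.inv ≫ Tr.mor₁, Tr.mor₂ ≫ e'.hom, e'.inv ≫ Tr.mor₃ ≫ e.hom⟦1⟧', ?_⟩
  refine isomorphic_distinguished _ hTr _ (Triangle.isoMk _ _ e.symm (Iso.refl _) e'.symm ?_ ?_ ?_)
  · change (e.inv ≫ Tr.mor₁) ≫ 𝟙 Tr.obj₂ = e.inv ≫ Tr.mor₁
    simp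
  · change (Tr.mor₂ ≫ e'.hom) ≫ e'.inv = 𝟙 Tr.obj₂ ≫ Tr.mor₂
    simp
  · change (e'.inv ≫ Tr.mor₃ ≫ e.hom⟦(1 : ℤ)⟧') ≫ e.inv⟦(1 : ℤ)⟧' = e'.inv ≫ Tr.mor₃
    rw [Category.assoc, Category.assoc, ← Functor.map_comp, e.hom_inv_id]
    simp

lemma starSet_iso {A B : Set T} {X Y : T} (e : X ≅ Y) (h : X ∈ starSet A B) :
    Y ∈ starSet A B := by
  obtain ⟨a, b, ha, hb, f, g, h, hT⟩ := h
  refine ⟨a, b, ha, hb, f ≫ e.hom, e.inv ≫ g, h, ?_⟩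
  refine isomorphic_distinguished _ hT _ (Triangle.isoMk _ _ (Iso.refl _) e.symm (Iso.refl _)
    ?_ ?_ ?_)
  · change (f ≫ e.hom) ≫ e.inv = 𝟙 a ≫ f
    simp
  · change (e.inv ≫ g) ≫ 𝟙 b = e.inv ≫ g
    simp
  · change h ≫ (𝟙 a)⟦(1 : ℤ)⟧' = 𝟙 b ≫ h
    simp

lemma posChain_iso {P : Set T} (hiso : ∀ ⦃A B : T⦄, (A ≅ B) → A ∈ P → B ∈ P) (n : ℕ)
    {X Y : T} (e : X ≅ Y) (h : X ∈ posChain P n) : Y ∈ posChain P n := by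
  cases n with
  | zero => exact hiso e h
  | succ n => exact starSet_iso e h

section exactness

variable {X Y Z F : T} {f : X ⟶ Y} {g : Y ⟶ Z} {h : Z ⟶ X⟦(1 : ℤ)⟧}

lemma z12 (hT : Triangle.mk f g h ∈ distTriang T) : f ≫ g = 0 :=
  comp_distTriang_mor_zero₁₂ _ hT

lemma z23 (hT : Triangle.mk f g h ∈ distTriang T) : g ≫ h = 0 :=
  comp_distTriang_mor_zero₂₃ _ hT

lemma z31 (hT : Triangle.mk f g h ∈ distTriang T) : h ≫ f⟦(1 : ℤ)⟧' = 0 :=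
  comp_distTriang_mor_zero₃₁ _ hT

lemma yo2 (hT : Triangle.mk f g h ∈ distTriang T) (w : Y ⟶ F) (hw : f ≫ w = 0) :
    ∃ k : Z ⟶ F, w = g ≫ k := Triangle.yoneda_exact₂ _ hT w hw

lemma yo3 (hT : Triangle.mk f g h ∈ distTriang T) (w : Z ⟶ F) (hw : g ≫ w = 0) :
    ∃ k : X⟦(1 : ℤ)⟧ ⟶ F, w = h ≫ k := Triangle.yoneda_exact₃ _ hT w hw

lemma coyo2 (hT : Triangle.mk f g h ∈ distTriang T) (w : F ⟶ Y) (hw : w ≫ g = 0) :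
    ∃ k : F ⟶ X, w = k ≫ f := Triangle.coyoneda_exact₂ _ hT w hw

lemma coyo3 (hT : Triangle.mk f g h ∈ distTriang T) (w : F ⟶ Z) (hw : w ≫ h = 0) :
    ∃ k : F ⟶ Y, w = k ≫ g := Triangle.coyoneda_exact₃ _ hT w hw

lemma coyo1 (hT : Triangle.mk f g h ∈ distTriang T) (w : F ⟶ X⟦(1 : ℤ)⟧)
    (hw : w ≫ f⟦(1 : ℤ)⟧' = 0) :
    ∃ k : F ⟶ Z, w = k ≫ h := Triangle.coyoneda_exact₁ _ hT w hw

lemma rot (hT : Triangle.mk f g h ∈ distTriang T) :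
    Triangle.mk g h (-(f⟦(1 : ℤ)⟧')) ∈ distTriang T := rot_of_distTriang _ hT

/-- `w : X → F` with `∂ ≫ w⟦1⟧ = 0` extends along `f`. -/
lemma yo1 (hT : Triangle.mk f g h ∈ distTriang T) (w : X ⟶ F) (hw : h ≫ w⟦(1 : ℤ)⟧' = 0) :
    ∃ w' : Y ⟶ F, w = f ≫ w' := by
  obtain ⟨k, hk⟩ := yo3 (rot hT) (w⟦1⟧') hw
  obtain ⟨k', rfl⟩ := (shiftFunctor T (1 : ℤ)).map_surjective k
  refine ⟨-k', (shiftFunctor T (1 : ℤ)).map_injective ?_⟩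
  rw [hk]
  simp

lemma coyo2s (hT : Triangle.mk f g h ∈ distTriang T) (w : F ⟶ Y⟦(1 : ℤ)⟧)
    (hw : w ≫ g⟦(1 : ℤ)⟧' = 0) :
    ∃ v : F ⟶ X⟦(1 : ℤ)⟧, w = v ≫ f⟦(1 : ℤ)⟧' := by
  obtain ⟨k, hk⟩ := coyo3 (rot (rot hT)) w (by simpa using hw)
  exact ⟨-k, by simpa using hk⟩

/-- A map into `X` killed by `f` is zero if all maps `F⟦1⟧ → Z` vanish. -/
lemma coyo_zero (hT : Triangle.mk f g h ∈ distTriang T) (w : F ⟶ X) (hw : w ≫ f = 0)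
    (hF : ∀ k : F⟦(1 : ℤ)⟧ ⟶ Z, k = 0) : w = 0 := by
  apply (Functor.map_eq_zero_iff (shiftFunctor T (1 : ℤ))).1
  obtain ⟨k, hk⟩ := coyo1 hT (w⟦(1 : ℤ)⟧') (by rw [← Functor.map_comp, hw, Functor.map_zero])
  rw [hk, hF k, zero_comp]

lemma map2 (hT : Triangle.mk f g h ∈ distTriang T) {X' Y' Z' : T} {f' : X' ⟶ Y'} {g' : Y' ⟶ Z'}
    {h' : Z' ⟶ X'⟦(1 : ℤ)⟧} (hT' : Triangle.mk f' g' h' ∈ distTriang T)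
    (a : X ⟶ X') (c : Z ⟶ Z') (comm : h ≫ a⟦(1 : ℤ)⟧' = c ≫ h') :
    ∃ b : Y ⟶ Y', f ≫ b = a ≫ f' ∧ g ≫ c = b ≫ g' :=
  complete_distinguished_triangle_morphism₂ _ _ hT hT' a c comm

end exactness
lemma thick_mem {P S : Set T} (hS : IsThick S) (hP : P ⊆ S) {E : T} {n : ℤ} (hE : E ∈ Pn P n) :
    E ∈ S := by
  obtain ⟨B, hB, ⟨e⟩⟩ := hE
  exact hS.iso e.symm (hS.shift _ (hP hB) n)

lemma thickClosure_isThick (P : Set T) : IsThick (thickClosure P) where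
  zero := fun _ hS => hS.1.zero
  iso := fun _ _ e h S hS => hS.1.iso e (h S hS)
  shift := fun X h n S hS => hS.1.shift X (h S hS) n
  ext₂ := fun Tr hTr h1 h3 S hS => hS.1.ext₂ Tr hTr (h1 S hS) (h3 S hS)
  retract := fun _ _ i r hir h S hS => hS.1.retract i r hir (h S hS)

lemma subset_thickClosure (P : Set T) : P ⊆ thickClosure P := fun _ h _ hS => hS.2 h

lemma Pn_thickClosure {P : Set T} {E : T} {n : ℤ} (hE : E ∈ Pn P n) : E ∈ thickClosure P :=
  thick_mem (thickClosure_isThick P) (subset_thickClosure P) hE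

lemma negChain_thick {P : Set T} (n : ℕ) {X : T} (h : X ∈ negChain P n) :
    X ∈ thickClosure P := by
  induction n generalizing X with
  | zero => obtain ⟨B, hB, rfl⟩ := h; exact Pn_thickClosure (Pn_mk hB _)
  | succ n ih =>
    obtain ⟨a, b, ⟨B, hB, rfl⟩, hb, f, g, h, hT⟩ := h
    exact (thickClosure_isThick P).ext₂ _ hT (Pn_thickClosure (Pn_mk hB _)) (ih hb)

lemma posChain_thick {P : Set T} (n : ℕ) {X : T} (h : X ∈ posChain P n) :
    X ∈ thickClosure P := by
  induction n generalizing X with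
  | zero => exact subset_thickClosure P h
  | succ n ih =>
    obtain ⟨a, b, ha, ⟨B, hB, rfl⟩, f, g, h, hT⟩ := h
    exact (thickClosure_isThick P).ext₂ _ hT (ih ha) (Pn_thickClosure (Pn_mk hB _))

lemma negChain_orth {P : Set T} {N : T} (hN : N ∈ rightPerp (negPart P)) (n : ℕ) {X : T}
    (h : X ∈ negChain P n) (u : X ⟶ N) : u = 0 := by
  rw [rightPerp_iff] at hN
  induction n generalizing X with
  | zero => obtain ⟨B, hB, rfl⟩ := h; exact hN (-1) (by lia) _ (Pn_mk hB _) u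
  | succ n ih =>
    obtain ⟨a, b, ⟨B, hB, rfl⟩, hb, f, g, h, hT⟩ := h
    obtain ⟨k, hk⟩ := yo2 hT u
      (hN (-((n : ℤ) + 2)) (by lia) _ (Pn_mk hB _) _)
    rw [hk, ih hb k, comp_zero]

lemma posChain_orth {P : Set T} {K : T} (hK : ∀ i : ℤ, 0 ≤ i → ∀ E ∈ Pn P i, ∀ f : K ⟶ E, f = 0)
    (n : ℕ) {Y : T} (h : Y ∈ posChain P n) (u : K ⟶ Y) : u = 0 := by
  induction n generalizing Y with
  | zero => exact hK 0 le_rfl _ ⟨Y, h, ⟨((shiftFunctorZero T ℤ).app Y).symm⟩⟩ u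
  | succ n ih =>
    obtain ⟨a, b, ha, ⟨B, hB, rfl⟩, f, g, h, hT⟩ := h
    obtain ⟨k, hk⟩ := coyo2 hT u
      (hK ((n : ℤ) + 1) (by lia) _ (Pn_mk hB _) _)
    rw [hk, ih ha k, zero_comp]

/-- `Y[1] ⊆ (P[<0])^⊥`, even a bit more. -/
lemma posChain_rightPerp {P : Set T} (hpre : presilting P) (n : ℕ) {Y : T}
    (h : Y ∈ posChain P n) {D : T} {j : ℤ} (hj : j < 0) (hD : D ∈ Pn P j) (u : D ⟶ Y) : u = 0 :=
  posChain_orth (fun _ hi _ hE f => Pn_hom hpre (by lia) hD hE f) n h u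

lemma posChain_shift_rightPerp {P : Set T} (hpre : presilting P) (n : ℕ) {Y : T}
    (h : Y ∈ posChain P n) : (Y⟦(1 : ℤ)⟧ : T) ∈ rightPerp (negPart P) := by
  rw [rightPerp_iff]
  intro i hi E hE
  exact tr1 (-1) 1 (by lia) (posChain_rightPerp hpre n h (by lia) (Pn_shift hE (-1) (i-1) (by lia)))

lemma Z_orth_Y {P : Set T} {M : T} (hM : M ∈ leftPerp (posPart P)) (n : ℕ) {Y : T}
    (h : Y ∈ posChain P n) (u : M ⟶ (Y⟦(1 : ℤ)⟧ : T)) : u = 0 := by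
  rw [leftPerp_iff] at hM
  refine tr1 (-1) 1 (by lia) (posChain_orth (fun i hi E hE => ?_) n h) u
  exact tr2 (-1) 1 (by lia) (hM (i+1) (by lia) _ (Pn_shift hE 1 (i+1) rfl))

lemma exists_rightApprox {P : Set T} (hcontra : contraFinite P (rightPerp (negPart P)))
    (l : ℤ) (A : T) (hA : ∀ j : ℤ, j < l → ∀ D ∈ Pn P j, ∀ f : D ⟶ A, f = 0) :
    ∃ (B : T) (_ : B ∈ P) (q : (B⟦l⟧ : T) ⟶ A),
      ∀ D ∈ Pn P l, ∀ v : D ⟶ A, ∃ w, v = w ≫ q := by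
  have hA' : (A⟦-l⟧ : T) ∈ rightPerp (negPart P) := by
    rw [rightPerp_iff]
    intro i hi E hE
    exact tr1 l _ (by lia) (hA (i + l) (by lia) _ (Pn_shift hE _ _ (by lia)))
  obtain ⟨B, b, hB, hb⟩ := hcontra _ hA'
  let F := shiftFunctor T l
  let e := (shiftFunctorCompIsoId T (-l) l (by lia)).app A
  refine ⟨B, hB, F.map b ≫ e.hom, ?_⟩
  rintro D ⟨B', hB', ⟨i⟩⟩ v
  obtain ⟨t, ht⟩ := F.map_surjective (X := B') (Y := A⟦-l⟧) (i.inv ≫ v ≫ e.inv)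
  obtain ⟨g, hg⟩ := hb B' hB' t
  refine ⟨i.hom ≫ F.map g, ?_⟩
  have : F.map g ≫ F.map b = i.inv ≫ v ≫ e.inv := by rw [← ht, ← hg, F.map_comp]
  rw [Category.assoc, reassoc_of% this]
  simp

lemma exists_leftApprox {P : Set T} (hcov : covFinite P (leftPerp (posPart P)))
    (l : ℤ) (A : T) (hA : ∀ j : ℤ, l < j → ∀ D ∈ Pn P j, ∀ f : A ⟶ D, f = 0) :
    ∃ (B : T) (_ : B ∈ P) (q : A ⟶ (B⟦l⟧ : T)),
      ∀ D ∈ Pn P l, ∀ v : A ⟶ D, ∃ w, v = q ≫ w := by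
  have hA' : (A⟦-l⟧ : T) ∈ leftPerp (posPart P) := by
    rw [leftPerp_iff]
    intro i hi E hE
    exact tr2 _ l (by lia) (hA (i + l) (by lia) _ (Pn_shift hE _ _ (by lia)))
  obtain ⟨B, b, hB, hb⟩ := hcov _ hA'
  let F := shiftFunctor T l
  let e := (shiftFunctorCompIsoId T (-l) l (by lia)).app A
  refine ⟨B, hB, e.inv ≫ F.map b, ?_⟩
  rintro D ⟨B', hB', ⟨i⟩⟩ v
  obtain ⟨t, ht⟩ := F.map_surjective (X := A⟦-l⟧) (Y := B') (e.hom ≫ v ≫ i.hom)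
  obtain ⟨g, hg⟩ := hb B' hB' t
  refine ⟨F.map g ≫ i.inv, ?_⟩
  have : F.map b ≫ F.map g = e.hom ≫ v ≫ i.hom := by rw [← ht, ← hg, F.map_comp]
  rw [Category.assoc, reassoc_of% this]
  simp

/-- Existence of the `X`-part. -/
lemma exists_X {P : Set T} (hpre : presilting P) (hcontra : contraFinite P (rightPerp (negPart P)))
    (l : ℕ) (A : T) (hA : ∀ j : ℤ, j < -((l : ℤ) + 1) → ∀ D ∈ Pn P j, ∀ f : D ⟶ A, f = 0) :
    ∃ (x : T) (_ : x ∈ negChain P l) (u : x ⟶ A),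
      (∀ j : ℤ, j < 0 → ∀ D ∈ Pn P j, ∀ v : D ⟶ A, ∃ w : D ⟶ x, v = w ≫ u) ∧
      (∀ j : ℤ, j < 0 → ∀ D ∈ Pn P j, ∀ w : D ⟶ x⟦(1 : ℤ)⟧, w ≫ u⟦(1 : ℤ)⟧' = 0 → w = 0) := by
  induction l generalizing A with
  | zero =>
    obtain ⟨B, hB, q, hq⟩ := exists_rightApprox hcontra (-1) A (by simpa using hA)
    refine ⟨_, ⟨B, hB, rfl⟩, q, ?_, ?_⟩
    · intro j hj D hD v
      rcases eq_or_lt_of_le (show j ≤ -1 by lia) with rfl | h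
      · exact hq D hD v
      · exact ⟨0, by rw [hA j (by simpa using h) D hD v, zero_comp]⟩
    · intro j hj D hD w _
      exact Pn_hom hpre hj hD (Pn_shift (Pn_mk hB _) 1 0 (by simp)) w
  | succ l ih =>
    obtain ⟨B, hB, q, hq⟩ := exists_rightApprox hcontra (-((l : ℤ) + 2)) A
      (fun j hj => hA j (by push_cast; lia))
    obtain ⟨A₁, p, d, hT⟩ := distinguished_cocone_triangle q
    have hA₁ : ∀ j : ℤ, j < -((l : ℤ) + 1) → ∀ D ∈ Pn P j, ∀ f : D ⟶ A₁, f = 0 := by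
      intro j hj D hD f
      obtain ⟨g, rfl⟩ := coyo3 hT f
        (Pn_hom hpre hj hD (Pn_shift (Pn_mk hB _) 1 _ (by ring)) _)
      rcases eq_or_lt_of_le (show j ≤ -((l : ℤ) + 2) by lia) with rfl | h
      · obtain ⟨w, rfl⟩ := hq D hD g
        rw [Category.assoc, z12 hT, comp_zero]
      · rw [hA j (by push_cast; lia) D hD g, zero_comp]
    obtain ⟨x₁, hx₁, u₁, hs, hi⟩ := ih A₁ hA₁
    obtain ⟨x, i, r, hT'⟩ := distinguished_cocone_triangle₂ (u₁ ≫ d)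
    obtain ⟨u, hu1, hu2⟩ := map2 hT' hT (𝟙 _) u₁ (by simp)
    rw [Category.id_comp] at hu1
    refine ⟨x, ⟨_, _, ⟨B, hB, rfl⟩, hx₁, i, r, _, hT'⟩, u, ?_, ?_⟩
    · intro j hj D hD v
      obtain ⟨w, hw⟩ := hs j hj D hD (v ≫ p)
      obtain ⟨w', rfl⟩ := coyo3 (F := D) hT' w
        (by rw [← Category.assoc, ← hw, Category.assoc, z23 hT, comp_zero])
      obtain ⟨k, hk⟩ := coyo2 hT (v - w' ≫ u) (by
        rw [Preadditive.sub_comp, hw, Category.assoc, Category.assoc, hu2, sub_self])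
      refine ⟨w' + k ≫ i, ?_⟩
      rw [Preadditive.add_comp, Category.assoc, hu1, ← hk]
      abel
    · intro j hj D hD w hw
      obtain ⟨v, rfl⟩ := coyo2s hT' w (hi j hj D hD _ (by
        rw [Category.assoc, ← Functor.map_comp, hu2, Functor.map_comp, reassoc_of% hw, zero_comp]))
      obtain ⟨g, rfl⟩ := coyo1 hT v (by
        rw [← hu1, Functor.map_comp, ← Category.assoc, hw])
      obtain ⟨g', rfl⟩ := hs j hj D hD g
      have := z31 hT'
      simp only [Category.assoc] at this ⊢
      rw [this, comp_zero]

/-- Existence of the `Y[1]`-part. -/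
lemma exists_Y {P : Set T} (hpre : presilting P)
    (hiso : ∀ ⦃A B : T⦄, (A ≅ B) → A ∈ P → B ∈ P)
    (hcov : covFinite P (leftPerp (posPart P)))
    (l : ℕ) (A : T) (hA : ∀ j : ℤ, (l : ℤ) + 1 < j → ∀ D ∈ Pn P j, ∀ f : A ⟶ D, f = 0) :
    ∃ (c : T) (_ : (c⟦(-1 : ℤ)⟧ : T) ∈ posChain P l) (r : A ⟶ c),
      (∀ j : ℤ, 0 < j → ∀ D ∈ Pn P j, ∀ v : A ⟶ D, ∃ w : c ⟶ D, v = r ≫ w) ∧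
      (∀ j : ℤ, 0 < j → ∀ D ∈ Pn P j, ∀ w : c ⟶ D⟦(1 : ℤ)⟧, r ≫ w = 0 → w = 0) := by
  induction l generalizing A with
  | zero =>
    obtain ⟨B, hB, q, hq⟩ := exists_leftApprox hcov 1 A (by simpa using hA)
    refine ⟨_, hiso ((shiftFunctorCompIsoId T (1 : ℤ) (-1) (by lia)).app B).symm hB, q, ?_, ?_⟩
    · intro j hj D hD v
      rcases eq_or_lt_of_le (show 1 ≤ j by lia) with rfl | h
      · exact hq D hD v
      · exact ⟨0, by rw [hA j (by simpa using h) D hD v, comp_zero]⟩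
    · intro j hj D hD w _
      exact Pn_hom hpre (by lia) (Pn_mk hB _) (Pn_shift hD 1 (j + 1) rfl) w
  | succ l ih =>
    obtain ⟨B, hB, q, hq⟩ := exists_leftApprox hcov ((l : ℤ) + 2) A
      (fun j hj => hA j (by push_cast; lia))
    obtain ⟨A₁, a, d, hT⟩ := distinguished_cocone_triangle₁ q
    have hA₁ : ∀ j : ℤ, (l : ℤ) + 1 < j → ∀ D ∈ Pn P j, ∀ f : A₁ ⟶ D, f = 0 := by
      intro j hj D hD f
      obtain ⟨g, rfl⟩ := yo1 hT f
        (Pn_hom hpre (by lia) (Pn_mk hB _) (Pn_shift hD 1 (j + 1) rfl) _)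
      rcases eq_or_lt_of_le (show (l : ℤ) + 2 ≤ j by lia) with rfl | h
      · obtain ⟨w, rfl⟩ := hq D hD g
        rw [← Category.assoc, z12 hT, zero_comp]
      · rw [hA j (by push_cast; lia) D hD g, comp_zero]
    obtain ⟨c₁, hc₁, r₁, hs, hi⟩ := ih A₁ hA₁
    obtain ⟨c, f, g, hT'⟩ := distinguished_cocone_triangle₂ (d ≫ r₁⟦(1 : ℤ)⟧')
    obtain ⟨r, hr1, hr2⟩ := map2 hT hT' r₁ (𝟙 _) (by simp)
    rw [Category.comp_id] at hr2
    refine ⟨c, ?_, r, ?_, ?_⟩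
    · exact starSet_of_iso _ (Triangle.shift_distinguished _ hT' (-1)) hc₁
        ⟨B, hB, rfl⟩ (Iso.refl _)
        ((shiftFunctorAdd' T ((l : ℤ) + 2) (-1) ((l : ℤ) + 1) (by ring)).app B).symm
    · intro j hj D hD v
      obtain ⟨w, hw⟩ := hs j hj D hD (a ≫ v)
      obtain ⟨w', rfl⟩ := yo1 (F := D) hT' w (by
        rw [Category.assoc, ← Functor.map_comp, ← hw, Functor.map_comp, ← Category.assoc,
          z31 hT, zero_comp])
      obtain ⟨k, hk⟩ := yo2 hT (v - r ≫ w') (by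
        rw [Preadditive.comp_sub, hw, reassoc_of% hr1, sub_self])
      refine ⟨w' + g ≫ k, ?_⟩
      rw [Preadditive.comp_add, ← Category.assoc, ← hr2, ← hk]
      abel
    · intro j hj D hD w hw
      obtain ⟨e, rfl⟩ := yo2 hT' w (hi j hj D hD _ (by
        rw [← Category.assoc, ← hr1, Category.assoc, hw, comp_zero]))
      obtain ⟨k, rfl⟩ := yo3 hT e (by rw [hr2, Category.assoc, hw])
      obtain ⟨k', rfl⟩ := (shiftFunctor T (1 : ℤ)).map_surjective k
      obtain ⟨k'', rfl⟩ := hs j hj D hD k'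
      have := z23 hT'
      rw [Functor.map_comp, ← Category.assoc d, ← Category.assoc, this, zero_comp]

lemma exists_bound {P : Set T}
    (hvan : ∀ A : T, ∃ N : ℤ, ∀ i : ℤ, N < i →
      (∀ B ∈ P, ∀ f : A ⟶ (B⟦i⟧ : T), f = 0) ∧ (∀ B ∈ P, ∀ f : B ⟶ (A⟦i⟧ : T), f = 0)) (A : T) :
    ∃ l : ℕ, (∀ j : ℤ, (l : ℤ) + 1 < j → ∀ D ∈ Pn P j, ∀ f : A ⟶ D, f = 0) ∧
      (∀ j : ℤ, j < -((l : ℤ) + 1) → ∀ D ∈ Pn P j, ∀ f : D ⟶ A, f = 0) := by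
  obtain ⟨N, hN⟩ := hvan A
  refine ⟨N.toNat, ?_, ?_⟩
  · rintro j hj D ⟨B, hB, ⟨e⟩⟩
    exact tr_iso_right e ((hN j (by lia)).1 B hB)
  · rintro j hj D ⟨B, hB, ⟨e⟩⟩
    exact tr_iso_left e (tr2 j (-j) (by lia) ((hN (-j) (by lia)).2 B hB))

lemma decomp {P : Set T} (hpre : presilting P)
    (hiso : ∀ ⦃A B : T⦄, (A ≅ B) → A ∈ P → B ∈ P)
    (hcov : covFinite P (leftPerp (posPart P)))
    (hcontra : contraFinite P (rightPerp (negPart P)))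
    (hvan : ∀ A : T, ∃ N : ℤ, ∀ i : ℤ, N < i →
      (∀ B ∈ P, ∀ f : A ⟶ (B⟦i⟧ : T), f = 0) ∧ (∀ B ∈ P, ∀ f : B ⟶ (A⟦i⟧ : T), f = 0)) (A : T) :
    A ∈ starSet (siltX P)
      (starSet (rightPerp (negPart P) ∩ leftPerp (posPart P)) (shiftSet (siltY P) 1)) := by
  obtain ⟨l, -, hl⟩ := exists_bound hvan A
  obtain ⟨x, hx, u, hs, hi⟩ := exists_X hpre hcontra l A hl
  obtain ⟨W, p, d, hT⟩ := distinguished_cocone_triangle u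
  refine ⟨x, W, Set.mem_iUnion.2 ⟨l, hx⟩, ?_, u, p, d, hT⟩
  have hW : ∀ j : ℤ, j < 0 → ∀ D ∈ Pn P j, ∀ v : D ⟶ W, v = 0 := by
    intro j hj D hD v
    obtain ⟨v', rfl⟩ := coyo3 hT v (hi j hj D hD _ (by rw [Category.assoc, z31 hT, comp_zero]))
    obtain ⟨w, rfl⟩ := hs j hj D hD v'
    rw [Category.assoc, z12 hT, comp_zero]
  obtain ⟨m, hm, -⟩ := exists_bound hvan W
  obtain ⟨c, hc, r, hs', hi'⟩ := exists_Y hpre hiso hcov m W hm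
  obtain ⟨z, a, b, hT'⟩ := distinguished_cocone_triangle₁ r
  refine starSet_of_iso (Triangle.mk a r b) hT' ⟨?_, ?_⟩
    ⟨_, Set.mem_iUnion.2 ⟨m, hc⟩, rfl⟩ (Iso.refl _)
    ((shiftFunctorCompIsoId T (-1 : ℤ) 1 (by lia)).app c).symm
  · change z ∈ _
    rw [rightPerp_iff]
    intro j hj D hD v
    refine coyo_zero hT' v (hW j hj D hD _) (tr2 1 (-1) (by lia) ?_)
    exact posChain_rightPerp hpre m hc hj hD
  · change z ∈ _
    rw [leftPerp_iff]
    intro j hj D hD v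
    obtain ⟨v', rfl⟩ := yo1 hT' v (hi' j hj D hD _ (by
      rw [← Category.assoc, z23 hT', zero_comp]))
    obtain ⟨w, rfl⟩ := hs' j hj D hD v'
    rw [← Category.assoc, z12 hT', zero_comp]
/-- A tower of objects approximating `obj 0` by `P[-n]`-coresolutions. -/
structure Tower (P : Set T) where
  obj : ℕ → T
  good : ∀ n : ℕ, ∀ j : ℤ, -(n : ℤ) < j → ∀ D ∈ Pn P j, ∀ f : obj n ⟶ D, f = 0
  map : ∀ n, obj (n + 1) ⟶ obj n
  E : ℕ → T
  hE : ∀ n : ℕ, E n ∈ Pn P (-(n : ℤ))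
  q : ∀ n, obj n ⟶ E n
  d : ∀ n, E n ⟶ (obj (n + 1))⟦(1 : ℤ)⟧
  dist : ∀ n, Triangle.mk (map n) (q n) (d n) ∈ distTriang T

lemma tower_step {P : Set T} (hpre : presilting P) (hcov : covFinite P (leftPerp (posPart P)))
    (n : ℕ) (A : T) (hA : ∀ j : ℤ, -(n : ℤ) < j → ∀ D ∈ Pn P j, ∀ f : A ⟶ D, f = 0) :
    ∃ (A' : T) (_ : ∀ j : ℤ, -((n + 1 : ℕ) : ℤ) < j → ∀ D ∈ Pn P j, ∀ f : A' ⟶ D, f = 0)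
      (t : A' ⟶ A) (E : T) (_ : E ∈ Pn P (-(n : ℤ))) (q : A ⟶ E) (d : E ⟶ A'⟦(1 : ℤ)⟧),
      Triangle.mk t q d ∈ distTriang T := by
  obtain ⟨B, hB, q, hq⟩ := exists_leftApprox hcov (-(n : ℤ)) A hA
  obtain ⟨A₁, a, d, hT⟩ := distinguished_cocone_triangle₁ q
  refine ⟨A₁, ?_, a, _, Pn_mk hB _, q, d, hT⟩
  intro j hj D hD f
  push_cast at hj
  obtain ⟨g, rfl⟩ := yo1 hT f
    (Pn_hom hpre (by lia) (Pn_mk hB _) (Pn_shift hD 1 (j + 1) rfl) _)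
  rcases eq_or_lt_of_le (show -(n : ℤ) ≤ j by lia) with rfl | h
  · obtain ⟨w, rfl⟩ := hq D hD g
    rw [← Category.assoc, z12 hT, zero_comp]
  · rw [hA j h D hD g, comp_zero]

lemma exists_tower {P : Set T} (hpre : presilting P) (hcov : covFinite P (leftPerp (posPart P)))
    (M : T) (hM : M ∈ leftPerp (posPart P)) : ∃ τ : Tower P, τ.obj 0 = M := by
  choose A' hA' t E hE q d hT using tower_step hpre hcov
  rw [leftPerp_iff] at hM
  let O : ∀ n : ℕ, {A : T // ∀ j : ℤ, -(n : ℤ) < j → ∀ D ∈ Pn P j, ∀ f : A ⟶ D, f = 0} :=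
    fun n => Nat.rec ⟨M, by simpa using hM⟩ (fun n A => ⟨A' n A.1 A.2, hA' n A.1 A.2⟩) n
  exact ⟨{  obj := fun n => (O n).1
            good := fun n => (O n).2
            map := fun n => t n (O n).1 (O n).2
            E := fun n => E n (O n).1 (O n).2
            hE := fun n => hE n (O n).1 (O n).2
            q := fun n => q n (O n).1 (O n).2
            d := fun n => d n (O n).1 (O n).2
            dist := fun n => hT n (O n).1 (O n).2 }, rfl⟩

namespace Tower

variable {P : Set T} (τ : Tower P)

/-- The tower as a functor. -/
def F : ℕᵒᵖ ⥤ T := Functor.ofOpSequence τ.map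

/-- The transition maps. -/
def s (n m : ℕ) (h : n ≤ m) : τ.obj m ⟶ τ.obj n := τ.F.map (homOfLE h).op

@[simp] lemma s_self (n : ℕ) (h : n ≤ n) : τ.s n n h = 𝟙 _ := τ.F.map_id _

lemma s_comp {a b c : ℕ} (h : a ≤ b) (h' : b ≤ c) :
    τ.s b c h' ≫ τ.s a b h = τ.s a c (h.trans h') := (τ.F.map_comp _ _).symm

lemma s_comp_assoc {a b c : ℕ} (h : a ≤ b) (h' : b ≤ c) {A : T} (f : τ.obj a ⟶ A) :
    τ.s b c h' ≫ τ.s a b h ≫ f = τ.s a c (h.trans h') ≫ f := by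
  rw [← Category.assoc, s_comp]

lemma s_succ (n : ℕ) : τ.s n (n + 1) (Nat.le_succ n) = τ.map n :=
  Functor.ofOpSequence_map_homOfLE_succ _ n

/-- Objects killed by the tower. -/
def kill : Set T :=
  {C | ∀ (k : ℤ) (n : ℕ) (f : τ.obj n ⟶ C⟦k⟧), ∃ (m : ℕ) (h : n ≤ m), τ.s n m h ≫ f = 0}

lemma kill_thick : IsThick τ.kill where
  zero := fun k n f => ⟨n, le_rfl,
    ((shiftFunctor T k).map_isZero (isZero_zero T)).eq_of_tgt _ _⟩
  iso := fun X Y e hX k n f => by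
    obtain ⟨m, h, hm⟩ := hX k n (f ≫ e.inv⟦k⟧')
    refine ⟨m, h, ?_⟩
    rw [← cancel_mono (e.inv⟦k⟧'), Category.assoc, hm, zero_comp]
  shift := fun X hX a k n f => by
    let e := (shiftFunctorAdd' T a k (a + k) rfl).app X
    obtain ⟨m, h, hm⟩ := hX (a + k) n (f ≫ e.inv)
    refine ⟨m, h, ?_⟩
    rw [← cancel_mono e.inv, Category.assoc, hm, zero_comp]
  ext₂ := fun Tr hTr h1 h3 k n f => by
    have hT := Triangle.shift_distinguished _ hTr k
    obtain ⟨m, h, hm⟩ := h3 k n (f ≫ ((shiftFunctor (Triangle T) k).obj Tr).mor₂)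
    obtain ⟨g, hg⟩ := Triangle.coyoneda_exact₂ _ hT (τ.s n m h ≫ f)
      ((Category.assoc _ _ _).trans hm)
    obtain ⟨m', h', hm'⟩ := h1 k m g
    refine ⟨m', h.trans h', ?_⟩
    rw [← τ.s_comp h h', Category.assoc]
    refine (congrArg (fun x => τ.s m m' h' ≫ x) hg).trans ?_
    refine (Category.assoc _ _ _).symm.trans ?_
    exact (congrArg (fun x => x ≫ ((shiftFunctor (Triangle T) k).obj Tr).mor₁) hm').trans zero_comp
  retract := fun X Y i r hir hY k n f => by
    obtain ⟨m, h, hm⟩ := hY k n (f ≫ i⟦k⟧')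
    refine ⟨m, h, ?_⟩
    have : f = (f ≫ i⟦k⟧') ≫ r⟦k⟧' := by
      rw [Category.assoc, ← Functor.map_comp, hir]; simp
    rw [this, ← Category.assoc, hm, zero_comp]

lemma P_kill : P ⊆ τ.kill := fun B hB k n f =>
  ⟨max n ((-k).toNat + 1), le_max_left _ _, τ.good _ k (by lia) _ (Pn_mk hB k) _⟩

lemma thick_kill {C : T} (hC : C ∈ thickClosure P) (n : ℕ) (k : ℤ) (f : τ.obj n ⟶ C⟦k⟧) :
    ∃ (m : ℕ) (h : n ≤ m), τ.s n m h ≫ f = 0 :=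
  hC _ ⟨τ.kill_thick, τ.P_kill⟩ k n f

lemma thick_kill' {C : T} (hC : C ∈ thickClosure P) (n : ℕ) (f : τ.obj n ⟶ C) :
    ∃ (m : ℕ) (h : n ≤ m), τ.s n m h ≫ f = 0 := by
  obtain ⟨m, h, hm⟩ := τ.thick_kill hC n 0 (f ≫ (shiftFunctorZero T ℤ).inv.app C)
  refine ⟨m, h, ?_⟩
  rw [← cancel_mono ((shiftFunctorZero T ℤ).inv.app C), Category.assoc, hm, zero_comp]

/-- Maps from the tower to a `(P[<0])^⊥`-object come from the bottom. -/
lemma lift_zero {N : T} (hN : N ∈ rightPerp (negPart P)) (n : ℕ) (f : τ.obj n ⟶ N) :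
    ∃ f₀ : τ.obj 0 ⟶ N, τ.s 0 n (Nat.zero_le n) ≫ f₀ = f := by
  rw [rightPerp_iff] at hN
  induction n with
  | zero => exact ⟨f, by simp⟩
  | succ n ih =>
    obtain ⟨g, rfl⟩ := yo1 (τ.dist n) f (by
      refine tr1 (-1) 1 (by lia) ?_ _
      exact hN (-(n : ℤ) - 1) (by lia) _ (Pn_shift (τ.hE n) (-1) _ (by lia)))
    obtain ⟨f₀, rfl⟩ := ih g
    exact ⟨f₀, by rw [← τ.s_succ, τ.s_comp_assoc]⟩

lemma factors_of_zero (hiso : ∀ ⦃A B : T⦄, (A ≅ B) → A ∈ P → B ∈ P)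
    {N : T} (hN : N ∈ rightPerp (negPart P)) (f : τ.obj 0 ⟶ N) (n : ℕ)
    (hf : τ.s 0 n (Nat.zero_le n) ≫ f = 0) : τ.s 0 1 (Nat.zero_le 1) ≫ f = 0 := by
  rw [rightPerp_iff] at hN
  induction n with
  | zero =>
    rw [s_self, Category.id_comp] at hf
    rw [hf, comp_zero]
  | succ n ih =>
    rcases Nat.eq_zero_or_pos n with rfl | hn
    · exact hf
    · apply ih
      obtain ⟨k, hk⟩ := yo2 (τ.dist n) (τ.s 0 n (Nat.zero_le n) ≫ f) (by
        rw [← τ.s_succ, τ.s_comp_assoc]; exact hf)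
      rw [hk, hN (-(n : ℤ)) (by lia) _ (τ.hE n) k, comp_zero]

lemma factors (hiso : ∀ ⦃A B : T⦄, (A ≅ B) → A ∈ P → B ∈ P)
    {N : T} (hN : N ∈ rightPerp (negPart P)) (f : τ.obj 0 ⟶ N) (n : ℕ)
    (hf : τ.s 0 n (Nat.zero_le n) ≫ f = 0) : factorsThrough P f := by
  have h1 := τ.factors_of_zero hiso hN f n hf
  obtain ⟨k, hk⟩ := yo2 (τ.dist 0) f (by rw [← τ.s_succ]; exact h1)
  obtain ⟨B, hB, ⟨e⟩⟩ := τ.hE 0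
  refine ⟨τ.E 0, hiso (e ≪≫ ?_).symm hB, τ.q 0, k, hk.symm⟩
  exact (shiftFunctorZero' T (-((0 : ℕ) : ℤ)) (by simp)).app B

/-- Equivalence of maps out of the tower. -/
def setoid (A : T) : Setoid (Σ n, τ.obj n ⟶ A) where
  r x y := ∃ (k : ℕ) (h : x.1 ≤ k) (h' : y.1 ≤ k), τ.s _ k h ≫ x.2 = τ.s _ k h' ≫ y.2
  iseqv :=
    { refl := fun x => ⟨x.1, le_rfl, le_rfl, rfl⟩
      symm := fun ⟨k, h, h', e⟩ => ⟨k, h', h, e.symm⟩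
      trans := by
        rintro x y z ⟨k, h, h', e⟩ ⟨l, g, g', e'⟩
        refine ⟨max k l, h.trans (le_max_left _ _), g'.trans (le_max_right _ _), ?_⟩
        rw [← τ.s_comp h (le_max_left _ _), Category.assoc, e, τ.s_comp_assoc,
          ← τ.s_comp g' (le_max_right _ _), Category.assoc, ← e', τ.s_comp_assoc] }

/-- The class of a map out of the tower. -/
def cls {A : T} (n : ℕ) (f : τ.obj n ⟶ A) : Quotient (τ.setoid A) := Quotient.mk _ ⟨n, f⟩

lemma cls_eq {A : T} {n m : ℕ} {f : τ.obj n ⟶ A} {g : τ.obj m ⟶ A} :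
    τ.cls n f = τ.cls m g ↔ ∃ (k : ℕ) (h : n ≤ k) (h' : m ≤ k), τ.s _ k h ≫ f = τ.s _ k h' ≫ g :=
  Quotient.eq (r := τ.setoid A)

/-- Postcomposition on classes. -/
def clsMap {A B : T} (b : A ⟶ B) : Quotient (τ.setoid A) → Quotient (τ.setoid B) :=
  Quotient.lift (fun x => τ.cls x.1 (x.2 ≫ b)) (by
    rintro ⟨n, f⟩ ⟨m, g⟩ ⟨k, h, h', e⟩
    refine τ.cls_eq.2 ⟨k, h, h', ?_⟩
    dsimp at e ⊢
    rw [← Category.assoc, e, Category.assoc])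

lemma clsMap_cls {A B : T} (b : A ⟶ B) (n : ℕ) (f : τ.obj n ⟶ A) :
    τ.clsMap b (τ.cls n f) = τ.cls n (f ≫ b) := rfl

lemma cls_ind {A : T} {p : Quotient (τ.setoid A) → Prop} (h : ∀ n f, p (τ.cls n f)) (x) : p x :=
  Quotient.ind (fun ⟨n, f⟩ => h n f) x

lemma clsMap_bijective {A B : T} (b : A ⟶ B) (hb : qis (thickClosure P) b) :
    Function.Bijective (τ.clsMap b) := by
  obtain ⟨C, g, h, hT, hC⟩ := hb
  constructor
  · intro x y
    induction x using τ.cls_ind with | h n f =>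
    induction y using τ.cls_ind with | h m f' =>
    rw [clsMap_cls, clsMap_cls, cls_eq, cls_eq]
    rintro ⟨k, hn, hm, e⟩
    obtain ⟨w, hw⟩ := Triangle.coyoneda_exact₂ _ (inv_rot_of_distTriang _ hT)
      (τ.s n k hn ≫ f - τ.s m k hm ≫ f') (by
        change _ ≫ b = 0
        rw [Preadditive.sub_comp, Category.assoc, e, Category.assoc, sub_self])
    obtain ⟨l, hl, e'⟩ := τ.thick_kill hC k (-1) w
    refine ⟨l, hn.trans hl, hm.trans hl, ?_⟩
    rw [← sub_eq_zero, ← τ.s_comp hn hl, ← τ.s_comp hm hl, Category.assoc, Category.assoc,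
      ← Preadditive.comp_sub]
    refine (congrArg (fun x => τ.s k l hl ≫ x) hw).trans ?_
    refine (Category.assoc _ _ _).symm.trans ?_
    exact (congrArg (fun x => x ≫ (Triangle.mk b g h).invRotate.mor₁) e').trans zero_comp
  · intro y
    induction y using τ.cls_ind with | h n f =>
    obtain ⟨m, hm, e⟩ := τ.thick_kill' hC n (f ≫ g)
    obtain ⟨k, hk⟩ := coyo2 hT (τ.s n m hm ≫ f) (by rw [Category.assoc, e])
    exact ⟨τ.cls m k, τ.cls_eq.2 ⟨m, le_rfl, hm, by rw [hk]; simp⟩⟩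

end Tower
section Loc

universe vT uT vU uU

variable {T : Type uT} [Category.{vT} T] [Preadditive T] [HasZeroObject T] [HasShift T ℤ]
  [∀ n : ℤ, (shiftFunctor T n).Additive] [Pretriangulated T]
  {U : Type uU} [Category.{vU} U] {P : Set T} (τ : Tower P)
  (Q : T ⥤ U) [Q.IsLocalization (qis (thickClosure P))]

/-- The functor of maps out of the tower. -/
def Tower.H : T ⥤ Type (max vT vU) where
  obj A := ULift.{vU} (Quotient (τ.setoid A))
  map b := TypeCat.ofHom (fun x => ULift.up (τ.clsMap b x.down))
  map_id A := by
    ext ⟨x⟩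
    induction x using τ.cls_ind with | h n f =>
    change τ.clsMap (𝟙 A) (τ.cls n f) = τ.cls n f
    rw [Tower.clsMap_cls, Category.comp_id]
  map_comp {A B C} a b := by
    ext ⟨x⟩
    induction x using τ.cls_ind with | h n f =>
    change τ.clsMap (a ≫ b) (τ.cls n f) = τ.clsMap b (τ.clsMap a (τ.cls n f))
    rw [Tower.clsMap_cls, Tower.clsMap_cls, Tower.clsMap_cls, Category.assoc]

lemma Tower.H_inv : (qis (thickClosure P)).IsInvertedBy (Tower.H.{vT, uT, vU} τ) := by
  intro A B b hb
  rw [isIso_iff_bijective]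
  obtain ⟨h1, h2⟩ := τ.clsMap_bijective b hb
  constructor
  · rintro ⟨x⟩ ⟨y⟩ h
    exact congrArg ULift.up (h1 (congrArg ULift.down h))
  · rintro ⟨y⟩
    obtain ⟨x, hx⟩ := h2 y
    exact ⟨ULift.up x, congrArg ULift.up hx⟩

lemma Tower.isIso_map (n : ℕ) : IsIso (Q.map (τ.map n)) :=
  Localization.inverts Q (qis (thickClosure P)) _
    ⟨_, _, _, τ.dist n, Pn_thickClosure (τ.hE n)⟩

lemma Tower.isIso_s (n : ℕ) : IsIso (Q.map (τ.s 0 n (Nat.zero_le n))) := by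
  induction n with
  | zero => rw [Tower.s_self]; infer_instance
  | succ n ih =>
    have := τ.isIso_map Q n
    rw [← τ.s_comp (Nat.zero_le n) (Nat.le_succ n), Tower.s_succ, Functor.map_comp]
    infer_instance

lemma Tower.faithful (hiso : ∀ ⦃A B : T⦄, (A ≅ B) → A ∈ P → B ∈ P)
    {N : T} (hN : N ∈ rightPerp (negPart P)) (f g : τ.obj 0 ⟶ N) (h : Q.map f = Q.map g) :
    factorsThrough P (f - g) := by
  have h1 : (Tower.H.{vT, uT, vU} τ).map f = (Tower.H.{vT, uT, vU} τ).map g := by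
    have e := Localization.fac (Tower.H.{vT, uT, vU} τ) τ.H_inv Q
    have hf := e.hom.naturality f
    have hg := e.hom.naturality g
    rw [Functor.comp_map] at hf hg
    rw [h] at hf
    rw [← cancel_epi (e.hom.app _), ← hf, ← hg]
  let u : (Tower.H.{vT, uT, vU} τ).obj (τ.obj 0) := ULift.up (τ.cls 0 (𝟙 _))
  have h2 : τ.cls 0 (𝟙 _ ≫ f) = τ.cls 0 (𝟙 _ ≫ g) :=
    congrArg ULift.down (ConcreteCategory.congr_hom h1 u)
  rw [Tower.cls_eq] at h2
  obtain ⟨k, _, _, e⟩ := h2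
  refine τ.factors hiso hN _ k ?_
  rw [Preadditive.comp_sub, sub_eq_zero]
  simpa using e

/-- The comparison with the localization. -/
noncomputable def Tower.toLoc (A : T) : Quotient (τ.setoid A) → (Q.obj (τ.obj 0) ⟶ Q.obj A) :=
  Quotient.lift (fun x => haveI := τ.isIso_s Q x.1
      inv (Q.map (τ.s 0 x.1 (Nat.zero_le _))) ≫ Q.map x.2) (by
    rintro ⟨n, f⟩ ⟨m, g⟩ ⟨k, h, h', e⟩
    dsimp at e h h' ⊢
    have := τ.isIso_s Q n
    have := τ.isIso_s Q m
    have := τ.isIso_s Q k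
    rw [← cancel_epi (Q.map (τ.s 0 k (Nat.zero_le _)))]
    conv_lhs => rw [← τ.s_comp (Nat.zero_le n) h, Functor.map_comp, Category.assoc,
      IsIso.hom_inv_id_assoc, ← Functor.map_comp, e]
    conv_rhs => rw [← τ.s_comp (Nat.zero_le m) h', Functor.map_comp, Category.assoc,
      IsIso.hom_inv_id_assoc, ← Functor.map_comp])

lemma Tower.toLoc_zero {A : T} (f : τ.obj 0 ⟶ A) : τ.toLoc Q A (τ.cls 0 f) = Q.map f := by
  have := τ.isIso_s Q 0
  change inv (Q.map (τ.s 0 0 (Nat.zero_le _))) ≫ Q.map f = _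
  rw [IsIso.inv_comp_eq, Tower.s_self, CategoryTheory.Functor.map_id, Category.id_comp]

lemma Tower.toLoc_map {A B : T} (b : A ⟶ B) (x : Quotient (τ.setoid A)) :
    τ.toLoc Q B (τ.clsMap b x) = τ.toLoc Q A x ≫ Q.map b := by
  induction x using τ.cls_ind with | h n f =>
  have := τ.isIso_s Q n
  change inv (Q.map (τ.s 0 n (Nat.zero_le _))) ≫ Q.map (f ≫ b) =
    (inv (Q.map (τ.s 0 n (Nat.zero_le _))) ≫ Q.map f) ≫ Q.map b
  rw [Functor.map_comp, Category.assoc]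

/-- The corepresentable functor in the right universe. -/
def Tower.G : U ⥤ Type (max vT vU) where
  obj A := ULift.{vT} (Q.obj (τ.obj 0) ⟶ A)
  map b := TypeCat.ofHom (fun x => ULift.up (x.down ≫ b))
  map_id A := by
    ext ⟨x⟩
    change x ≫ 𝟙 A = x
    rw [Category.comp_id]
  map_comp {A B C} a b := by
    ext ⟨x⟩
    change x ≫ a ≫ b = (x ≫ a) ≫ b
    rw [Category.assoc]

/-- The comparison as a natural transformation. -/
noncomputable def Tower.nat : Tower.H.{vT, uT, vU} τ ⟶ Q ⋙ τ.G Q where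
  app A := TypeCat.ofHom (fun x => ULift.up (τ.toLoc Q A x.down))
  naturality A B b := by
    ext ⟨x⟩
    exact congrArg ULift.up (τ.toLoc_map Q b x)

lemma Tower.full {N : T} (hN : N ∈ rightPerp (negPart P)) (φ : Q.obj (τ.obj 0) ⟶ Q.obj N) :
    ∃ f : τ.obj 0 ⟶ N, Q.map f = φ := by
  let W := qis (thickClosure P)
  let H := Tower.H.{vT, uT, vU} τ
  let K := Localization.lift H τ.H_inv Q
  let e : Q ⋙ K ≅ H := Localization.fac H τ.H_inv Q
  let α : K ⟶ τ.G Q := Localization.liftNatTrans Q W H (Q ⋙ τ.G Q) K (τ.G Q) (τ.nat Q)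
  have hα : ∀ A, α.app (Q.obj A) = e.hom.app A ≫ (τ.nat Q).app A := fun A => by
    refine (Localization.liftNatTrans_app Q W H (Q ⋙ τ.G Q) K (τ.G Q) (τ.nat Q) A).trans ?_
    exact congrArg (fun x => e.hom.app A ≫ x) (Category.comp_id _)
  let u : H.obj (τ.obj 0) := ULift.up (τ.cls 0 (𝟙 _))
  let x : K.obj (Q.obj (τ.obj 0)) := e.inv.app _ u
  have hx : e.hom.app _ x = u := ConcreteCategory.congr_hom (e.inv_hom_id_app (τ.obj 0)) u
  have h1 : α.app _ x = ULift.up (𝟙 _) := by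
    refine (ConcreteCategory.congr_hom (hα _) x).trans ?_
    change (τ.nat Q).app _ (e.hom.app _ x) = _
    rw [hx]
    change ULift.up (τ.toLoc Q _ (τ.cls 0 (𝟙 _))) = _
    rw [τ.toLoc_zero, CategoryTheory.Functor.map_id]
  have h2 : α.app _ (K.map φ x) = ULift.up φ := by
    refine (ConcreteCategory.congr_hom (α.naturality φ) x).trans ?_
    change (τ.G Q).map φ (α.app _ x) = _
    rw [h1]
    change ULift.up (𝟙 _ ≫ φ) = _
    rw [Category.id_comp]
  obtain ⟨f, hf⟩ : ∃ f : τ.obj 0 ⟶ N, e.hom.app N (K.map φ x) = ULift.up (τ.cls 0 f) := by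
    obtain ⟨y⟩ := e.hom.app N (K.map φ x)
    induction y using τ.cls_ind with | h n g =>
    obtain ⟨f, rfl⟩ := τ.lift_zero hN n g
    refine ⟨f, congrArg ULift.up (τ.cls_eq.2 ⟨n, le_rfl, Nat.zero_le n, ?_⟩)⟩
    rw [Tower.s_self, Category.id_comp]
  refine ⟨f, ?_⟩
  have h3 := (ConcreteCategory.congr_hom (hα N) (K.map φ x)).symm.trans h2
  change (τ.nat Q).app _ (e.hom.app N (K.map φ x)) = _ at h3
  rw [hf] at h3
  have h4 : τ.toLoc Q N (τ.cls 0 f) = φ := congrArg ULift.down h3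
  rw [← h4, τ.toLoc_zero]

lemma map_eq_of_factors [HasBinaryBiproducts T] {M N : T} (f g : M ⟶ N)
    (h : factorsThrough P (f - g)) : Q.map f = Q.map g := by
  obtain ⟨B, hB, u, v, e⟩ := h
  have hq : qis (thickClosure P) (biprod.snd : B ⊞ M ⟶ M) :=
    ⟨_, _, _, rot_of_distTriang _ (binaryBiproductTriangle_distinguished B M),
      (thickClosure_isThick P).shift _ (subset_thickClosure P hB) 1⟩
  have := Localization.inverts Q _ _ hq
  have h1 : Q.map (biprod.lift u (𝟙 M)) = Q.map (biprod.lift (0 : M ⟶ B) (𝟙 M)) := by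
    rw [← cancel_mono (Q.map (biprod.snd : B ⊞ M ⟶ M)), ← Functor.map_comp, ← Functor.map_comp,
      biprod.lift_snd, biprod.lift_snd]
  have hf : f = biprod.lift u (𝟙 M) ≫ biprod.desc v g := by
    rw [biprod.lift_desc, e]; simp
  have hg : g = biprod.lift (0 : M ⟶ B) (𝟙 M) ≫ biprod.desc v g := by
    rw [biprod.lift_desc]; simp
  rw [hf, Functor.map_comp, h1, ← Functor.map_comp, ← hg]

end Loc

/-- silting reduction. Let `P` be a presilting subcategory with
`P = add P`, `S = thick P`, `P` covariantly finite in `^⊥(P[>0])` and contravariantly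
finite in `(P[<0])^⊥`, with the boundedness condition (P2). Then `Z ⊂ T → T/S` induces a
triangle equivalence `Z/[P] ≃ T/S` (density, fullness, kernel the ideal `[P]`), and
`T = X ⊥ Z ⊥ Y[1]`. -/
theorem stmt9 {U : Type*} [Category U] [HasBinaryBiproducts T] (P : Set T) (Q : T ⥤ U)
    [Q.IsLocalization (qis (thickClosure P))]
    (hpre : presilting P)
    (hiso : ∀ ⦃A B : T⦄, (A ≅ B) → A ∈ P → B ∈ P)
    (hretract : ∀ ⦃A B : T⦄ (i : A ⟶ B) (r : B ⟶ A), i ≫ r = 𝟙 A → B ∈ P → A ∈ P)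
    (hsum : ∀ A ∈ P, ∀ B ∈ P, (A ⊞ B : T) ∈ P)
    (hcov : covFinite P (leftPerp (posPart P)))
    (hcontra : contraFinite P (rightPerp (negPart P)))
    (hvan : ∀ A : T, ∃ N : ℤ, ∀ i : ℤ, N < i →
      (∀ B ∈ P, ∀ f : A ⟶ (B⟦i⟧ : T), f = 0) ∧ (∀ B ∈ P, ∀ f : B ⟶ (A⟦i⟧ : T), f = 0)) :
    (∀ A : U, ∃ Z₀ ∈ rightPerp (negPart P) ∩ leftPerp (posPart P),
      Nonempty (A ≅ Q.obj Z₀)) ∧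
    (∀ M ∈ rightPerp (negPart P) ∩ leftPerp (posPart P),
     ∀ N ∈ rightPerp (negPart P) ∩ leftPerp (posPart P),
      (∀ φ : Q.obj M ⟶ Q.obj N, ∃ f : M ⟶ N, Q.map f = φ) ∧
      (∀ f g : M ⟶ N, Q.map f = Q.map g ↔ factorsThrough P (f - g))) ∧
    homOrth (siltX P) (rightPerp (negPart P) ∩ leftPerp (posPart P)) ∧
    homOrth (siltX P) (shiftSet (siltY P) 1) ∧
    homOrth (rightPerp (negPart P) ∩ leftPerp (posPart P)) (shiftSet (siltY P) 1) ∧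
    (∀ T₀ : T, T₀ ∈ starSet (siltX P)
      (starSet (rightPerp (negPart P) ∩ leftPerp (posPart P)) (shiftSet (siltY P) 1))) := by
  refine ⟨?_, ?_, ?_, ?_, ?_, decomp hpre hiso hcov hcontra hvan⟩
  · intro A
    have := Localization.essSurj Q (qis (thickClosure P))
    obtain ⟨x, W, hx, hW, a, b, c, hT⟩ := decomp hpre hiso hcov hcontra hvan (Q.objPreimage A)
    obtain ⟨z, y', hz, ⟨y, hy, rfl⟩, a', b', c', hT'⟩ := hW
    obtain ⟨n, hn⟩ := Set.mem_iUnion.1 hx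
    obtain ⟨m, hm⟩ := Set.mem_iUnion.1 hy
    have h1 : qis (thickClosure P) b :=
      ⟨_, _, _, rot hT, (thickClosure_isThick P).shift _ (negChain_thick n hn) 1⟩
    have h2 : qis (thickClosure P) a' :=
      ⟨_, _, _, hT', (thickClosure_isThick P).shift _ (posChain_thick m hm) 1⟩
    exact ⟨z, hz, ⟨(Q.objObjPreimageIso A).symm ≪≫
      Localization.isoOfHom Q _ b h1 ≪≫ (Localization.isoOfHom Q _ a' h2).symm⟩⟩
  · intro M hM N hN
    obtain ⟨τ, rfl⟩ := exists_tower hpre hcov M hM.2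
    exact ⟨τ.full Q hN.1, fun f g => ⟨τ.faithful Q hiso hN.1 f g, map_eq_of_factors Q f g⟩⟩
  · intro x hx z hz f
    obtain ⟨n, hn⟩ := Set.mem_iUnion.1 hx
    exact negChain_orth hz.1 n hn f
  · rintro x hx _ ⟨y, hy, rfl⟩ f
    obtain ⟨n, hn⟩ := Set.mem_iUnion.1 hx
    obtain ⟨m, hm⟩ := Set.mem_iUnion.1 hy
    exact negChain_orth (posChain_shift_rightPerp hpre m hm) n hn f
  · rintro z hz _ ⟨y, hy, rfl⟩ f
    obtain ⟨m, hm⟩ := Set.mem_iUnion.1 hy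
    exact Z_orth_Y hz.2 m hm f


end IY
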